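/- Let 𝒮 be a family of subsets of a set X with VC dimension at most k, let q and n be such that the dual (p,q)-theorem holds for families of VC dimension at most k with these parameters, and let U ⊆ X be any (possibly infinite) set such that every subset U₀ ⊆ U of size at most q is contained in some member of 𝒮. Then, assuming 𝒮 is closed under a compactness property (𝒮 is the family of instances of a formula in a saturated structure), U is covered by the union of n members of 𝒮. In the purely finite setting: if U is finite and every q-subset of U is contained in some S ∈ 𝒮, then U ⊆ S₁ ∪ ⋯ ∪ Sₙ for some Sᵢ ∈ 𝒮. -/

import Mathlib

/-- A finite set `A` is shattered by the set system `𝒮`. -/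
def ShattersFam {X : Type*} (𝒮 : Set (Set X)) (A : Finset X) : Prop :=
  ∀ B ⊆ A, ∃ S ∈ 𝒮, (A : Set X) ∩ S = (B : Set X)

/-- The VC dimension of `𝒮` is at most `k`. -/
def VCDimLE {X : Type*} (𝒮 : Set (Set X)) (k : ℕ) : Prop :=
  ∀ A : Finset X, ShattersFam 𝒮 A → A.card ≤ k

namespace PQ
open Finset

def Sh {Ω Λ : Type*} (R : Ω → Λ → Prop) (ι : Type*) : Prop :=
  ∃ x : ι → Ω, ∀ B : Set ι, ∃ l, ∀ i, R (x i) l ↔ i ∈ B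

lemma Sh.comp {Ω Λ ι κ : Type*} {R : Ω → Λ → Prop} (e : κ → ι) (he : Function.Injective e)
    (h : Sh R ι) : Sh R κ := by
  obtain ⟨x, hx⟩ := h
  refine ⟨x ∘ e, fun B => ?_⟩
  obtain ⟨l, hl⟩ := hx (e '' B)
  exact ⟨l, fun i => by simp [hl, he.mem_set_image]⟩

lemma Sh.dual {Ω Λ : Type*} {R : Ω → Λ → Prop} {n : ℕ}
    (h : Sh R (Fin (2 ^ n))) : Sh (fun l w => R w l) (Fin n) := by
  have e : Set (Fin n) ≃ Fin (2 ^ n) := Fintype.equivFinOfCardEq (by simp)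
  obtain ⟨x, hx⟩ := h.comp e e.injective
  choose l hl using fun a : Fin n => hx {s | a ∈ s}
  exact ⟨l, fun B => ⟨x B, fun i => by simp [hl]⟩⟩

lemma Sh.compl {Ω Λ ι : Type*} {R : Ω → Λ → Prop}
    (h : Sh (fun w l => ¬ R w l) ι) : Sh R ι := by
  obtain ⟨x, hx⟩ := h
  refine ⟨x, fun B => ?_⟩
  obtain ⟨l, hl⟩ := hx Bᶜ
  exact ⟨l, fun i => by have := hl i; simp at this; tauto⟩

open Classical in
lemma trace_bound {Ω Λ J : Type*} [Fintype J] [Nonempty J] {R : Ω → Λ → Prop} {D : ℕ}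
    (hD : 0 < D) (h : ¬ Sh R (Fin D)) (z : J → Ω) :
    #(univ.filter fun T : Finset J => ∃ l, ∀ j, j ∈ T ↔ R (z j) l) ≤ D * Fintype.card J ^ D := by
  set 𝒜 := univ.filter fun T : Finset J => ∃ l, ∀ j, j ∈ T ↔ R (z j) l with h𝒜
  have hs : ∀ s, 𝒜.Shatters s → s.card < D := by
    intro s hs
    by_contra! hc
    apply h
    obtain ⟨t, hts, htc⟩ := exists_subset_card_eq hc
    let e := (t.equivFinOfCardEq htc).symm
    refine ⟨fun i => z (e i), fun B => ?_⟩
    obtain ⟨u, hu, hsu⟩ := hs (t := s.filter fun j => ∃ i ∈ B, (e i : J) = j) (filter_subset _ _)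
    simp only [h𝒜, mem_filter, mem_univ, true_and] at hu
    obtain ⟨l, hl⟩ := hu
    refine ⟨l, fun i => ?_⟩
    rw [← hl]
    have := congrArg (fun a => (e i : J) ∈ a) hsu
    have h1 : (e i : J) ∈ s := hts (e i).2
    simp only [mem_inter, h1, true_and, mem_filter, eq_iff_iff] at this
    rw [this]
    constructor
    · rintro ⟨i', hi', he⟩
      have := e.injective (Subtype.ext he)
      rwa [← this]
    · intro hi; exact ⟨i, hi, rfl⟩
  have hvc : 𝒜.vcDim < D := by
    unfold vcDim
    rw [Finset.sup_lt_iff (by simpa using hD)]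
    intro s hs'
    exact hs s (mem_shatterer.mp hs')
  calc #𝒜 ≤ _ := card_le_card_shatterer 𝒜
    _ ≤ _ := card_shatterer_le_sum_vcDim
    _ ≤ ∑ i ∈ range D, Fintype.card J ^ D := by
      refine (sum_le_sum_of_subset (t := range D) ?_).trans (sum_le_sum ?_)
      · intro i; simp; omega
      · intro i hi
        refine (Nat.choose_le_pow _ _).trans (Nat.pow_le_pow_right Fintype.card_pos ?_)
        simp at hi; omega
    _ = _ := by simp

lemma exists_t (D : ℕ) : ∃ t, 0 < t ∧ 8 * (D * (16 * t) ^ D) < 2 ^ t := by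
  have h := tendsto_pow_const_div_const_pow_of_one_lt D (r := (2:ℝ)) (by norm_num)
  have hc : (0:ℝ) < 1 / (8 * D * 16 ^ D + 1) := by positivity
  obtain ⟨t, h1, h2⟩ := ((h.eventually (gt_mem_nhds hc)).and (Filter.eventually_gt_atTop 0)).exists
  refine ⟨t, h2, ?_⟩
  rw [div_lt_div_iff₀ (by positivity) (by positivity)] at h1
  have h3 : (0:ℝ) < (t:ℝ) ^ D := by positivity
  have : (8 * (D * (16 * t) ^ D) : ℝ) < 2 ^ t := by rw [mul_pow]; nlinarith
  exact_mod_cast this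

lemma count_sigma {m t : ℕ} (T : Finset (Fin m × Bool)) (htm : t ≤ m) :
    #(univ.filter fun σ : Fin m → Bool => (∀ i, (i, σ i) ∉ T) ∧
      t ≤ #(univ.filter fun i => (i, !σ i) ∈ T)) ≤ 2 ^ (m - t) := by
  set A := univ.filter fun σ : Fin m → Bool => (∀ i, (i, σ i) ∉ T) ∧
      t ≤ #(univ.filter fun i => (i, !σ i) ∈ T) with hA
  rcases A.eq_empty_or_nonempty with h | ⟨σ, hσ⟩
  · simp [h]
  simp only [hA, mem_filter, mem_univ, true_and] at hσ
  obtain ⟨h1, h2⟩ := hσ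
  set I := univ.filter fun i => (i, !σ i) ∈ T with hI
  have hsub : A ⊆ Fintype.piFinset (fun i => if i ∈ I then {σ i} else univ) := by
    intro τ hτ
    simp only [hA, mem_filter, mem_univ, true_and] at hτ
    rw [Fintype.mem_piFinset]
    intro i
    split_ifs with hi
    · simp only [hI, mem_filter, mem_univ, true_and] at hi
      have := hτ.1 i
      rw [mem_singleton]
      by_contra hne
      have h3 : τ i = !σ i := by cases hh : τ i <;> cases hh' : σ i <;> simp_all
      rw [h3] at this; exact this hi
    · simp
  refine (card_le_card hsub).trans ?_
  rw [Fintype.card_piFinset]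
  have : ∀ i, #(if i ∈ I then {σ i} else (univ : Finset Bool)) = if i ∈ I then 1 else 2 := by
    intro i; split_ifs <;> simp
  simp only [this]
  rw [prod_ite]
  simp only [prod_const_one, one_mul, prod_const]
  apply Nat.pow_le_pow_right (by norm_num)
  have h4 : #(univ.filter fun i => i ∉ I) = m - #I := by
    rw [filter_not, card_sdiff_of_subset (by simp)]; simp
  omega

open Classical in
lemma net {Ω Λ : Type*} [Fintype Ω] [Nonempty Ω] {R : Ω → Λ → Prop} {D t : ℕ}
    (hD : 0 < D) (ht : 0 < t) (hDt : 8 * (D * (16 * t) ^ D) < 2 ^ t) (h : ¬ Sh R (Fin D)) :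
    ∃ x : Fin (8 * t) → Ω, ∀ l, Fintype.card Ω ≤ 4 * #(univ.filter fun w => R w l) →
      ∃ i, R (x i) l := by
  by_contra! hcon
  obtain ⟨m, hm⟩ : ∃ m, m = 8 * t := ⟨_, rfl⟩
  rw [← hm] at hcon
  choose L hL1 hL2 using hcon
  set M := Fintype.card Ω with hM
  have hMpos : 0 < M := Fintype.card_pos
  let g : (Fin m → Ω) × (Fin m → Ω) → ℕ := fun p => #(univ.filter fun i => R (p.2 i) (L p.1))
  -- lower bound
  have hlow : m * (M ^ m * M ^ m) ≤ 4 * ∑ p, g p := by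
    rw [Fintype.sum_prod_type]
    have : ∀ x : Fin m → Ω, m * M ^ m ≤ 4 * ∑ y, g (x, y) := by
      intro x
      have h1 : ∑ y, g (x, y) = ∑ i : Fin m, #(univ.filter fun y : Fin m → Ω => R (y i) (L x)) := by
        simp only [g, card_filter]
        rw [sum_comm]
      have h2 : ∀ i : Fin m, M ^ m ≤ 4 * #(univ.filter fun y : Fin m → Ω => R (y i) (L x)) := by
        intro i
        have h3 : (univ.filter fun y : Fin m → Ω => R (y i) (L x)) =
            Fintype.piFinset (fun j => if j = i then univ.filter (fun w => R w (L x)) else univ) := by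
          ext y
          simp only [mem_filter, mem_univ, true_and, Fintype.mem_piFinset]
          constructor
          · intro hy j; split_ifs with hj
            · subst hj; simpa using hy
            · simp
          · intro hy; simpa using hy i
        rw [h3, Fintype.card_piFinset, Fintype.prod_eq_mul_prod_compl i]
        have h5 : ∏ j ∈ {i}ᶜ, #(if j = i then univ.filter (fun w => R w (L x)) else univ)
            = M ^ (m - 1) := by
          rw [prod_congr rfl (g := fun _ => M)]
          · simp [card_compl]
          · intro j hj
            simp at hj; simp [hj, hM]
        rw [h5]
        simp only [if_true]
        have h6 : M ^ m = M * M ^ (m - 1) := by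
          rw [← pow_succ']; congr 1; omega
        rw [h6, ← mul_assoc]
        exact Nat.mul_le_mul_right _ (hL1 x)
      rw [h1, mul_sum]
      calc m * M ^ m = ∑ i : Fin m, M ^ m := by simp
        _ ≤ _ := sum_le_sum fun i _ => h2 i
    rw [mul_sum]
    calc m * (M ^ m * M ^ m) = ∑ x : Fin m → Ω, m * M ^ m := by simp [← hM]; ring
      _ ≤ _ := sum_le_sum fun i _ => this i
  -- swapping
  let sw : (Fin m → Bool) → (Fin m → Ω) × (Fin m → Ω) → (Fin m → Ω) × (Fin m → Ω) :=
    fun σ p => (fun i => if σ i then p.2 i else p.1 i, fun i => if σ i then p.1 i else p.2 i)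
  have hinv : ∀ σ, Function.Involutive (sw σ) := by
    intro σ p
    ext i <;> simp only [sw] <;> split_ifs <;> rfl
  have hsw : ∀ σ, ∑ p, g (sw σ p) = ∑ p, g p := fun σ =>
    Equiv.sum_comp ((hinv σ).toPerm) g
  set N := D * (16 * t) ^ D with hN
  have hup : ∀ p, ∑ σ, g (sw σ p) ≤ 2 ^ m * t + m * (N * 2 ^ (m - t)) := by
    intro p
    let z : Fin m × Bool → Ω := fun a => if a.2 then p.2 a.1 else p.1 a.1
    have : Nonempty (Fin m × Bool) := ⟨⟨⟨0, by omega⟩, true⟩⟩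
    have htr := trace_bound hD h z
    have hcJ : Fintype.card (Fin m × Bool) = 16 * t := by simp [hm]; ring
    rw [hcJ, ← hN] at htr
    have hb : #(univ.filter fun σ => t ≤ g (sw σ p)) ≤ N * 2 ^ (m - t) := by
      have hsub : (univ.filter fun σ => t ≤ g (sw σ p)) ⊆
          (univ.filter fun T : Finset (Fin m × Bool) => ∃ l, ∀ j, j ∈ T ↔ R (z j) l).biUnion
          (fun T => univ.filter fun σ : Fin m → Bool => (∀ i, (i, σ i) ∉ T) ∧
            t ≤ #(univ.filter fun i => (i, !σ i) ∈ T)) := by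
        intro σ hσ
        simp only [mem_filter, mem_univ, true_and] at hσ
        rw [mem_biUnion]
        refine ⟨univ.filter fun j => R (z j) (L (sw σ p).1), ?_, ?_⟩
        · simp only [mem_filter, mem_univ, true_and]
          exact ⟨_, fun j => Iff.rfl⟩
        · simp only [mem_filter, mem_univ, true_and]
          refine ⟨fun i => ?_, ?_⟩
          · have := hL2 (sw σ p).1 i
            simpa only [z, sw] using this
          · convert hσ using 5 with i
            simp only [z, sw]
            cases σ i <;> simp
      refine (card_le_card hsub).trans (card_biUnion_le.trans ?_)
      calc _ ≤ ∑ T ∈ (univ.filter fun T : Finset (Fin m × Bool) => ∃ l, ∀ j, j ∈ T ↔ R (z j) l),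
              2 ^ (m - t) := sum_le_sum fun T _ => count_sigma T (by omega)
        _ ≤ _ := by
          rw [sum_const, smul_eq_mul]
          exact Nat.mul_le_mul_right _ htr
    have hg : ∀ σ, g (sw σ p) ≤ t + m * (if t ≤ g (sw σ p) then 1 else 0) := by
      intro σ
      have : g (sw σ p) ≤ m := (card_le_univ _).trans (by simp)
      split_ifs <;> omega
    calc ∑ σ, g (sw σ p) ≤ ∑ σ, (t + m * (if t ≤ g (sw σ p) then 1 else 0)) :=
          sum_le_sum fun σ _ => hg σ
      _ = 2 ^ m * t + m * #(univ.filter fun σ => t ≤ g (sw σ p)) := by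
          rw [sum_add_distrib, ← mul_sum, card_filter]; simp
      _ ≤ _ := by gcongr
  have hfin : 2 ^ m * ∑ p, g p ≤ (M ^ m * M ^ m) * (2 ^ m * t + m * (N * 2 ^ (m - t))) := by
    calc 2 ^ m * ∑ p, g p = ∑ σ : Fin m → Bool, ∑ p, g (sw σ p) := by simp [hsw]
      _ = ∑ p, ∑ σ : Fin m → Bool, g (sw σ p) := sum_comm
      _ ≤ ∑ p : (Fin m → Ω) × (Fin m → Ω), (2 ^ m * t + m * (N * 2 ^ (m - t))) :=
          sum_le_sum fun p _ => hup p
      _ = _ := by simp [← hM]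
  have hP : 0 < M ^ m * M ^ m := by positivity
  set P := M ^ m * M ^ m
  have h2m : 2 ^ m = 2 ^ t * 2 ^ (m - t) := by rw [← pow_add]; congr 1; omega
  have hA : 0 < 2 ^ (m - t) := by positivity
  set A := 2 ^ (m - t)
  have e1 : P * (2 ^ m * m) ≤ P * (4 * (2 ^ m * t + m * (N * A))) := by
    calc P * (2 ^ m * m) = 2 ^ m * (m * P) := by ring
      _ ≤ 2 ^ m * (4 * ∑ p, g p) := Nat.mul_le_mul_left _ hlow
      _ = 4 * (2 ^ m * ∑ p, g p) := by ring
      _ ≤ 4 * (P * (2 ^ m * t + m * (N * A))) := Nat.mul_le_mul_left _ hfin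
      _ = _ := by ring
  have e2 := Nat.le_of_mul_le_mul_left e1 hP
  rw [h2m, hm] at e2
  have e3 : (t * A) * (4 * 2 ^ t) ≤ (t * A) * (32 * N) := by nlinarith
  have e4 := Nat.le_of_mul_le_mul_left e3 (by positivity)
  omega

open Classical in
lemma boost {V Λ : Type*} [Fintype V] (R : V → Λ → Prop)
    (H : ∀ w : V → ℕ, ∃ l, 4 * ∑ v, (if R v l then 0 else w v) ≤ ∑ v, w v) (T : ℕ) :
    ∃ g : Fin T → Λ, 4 ^ T * ∑ v, ∏ j, (if R v (g j) then 1 else 2) ≤ 5 ^ T * Fintype.card V := by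
  induction T with
  | zero => exact ⟨fun i => i.elim0, by simp⟩
  | succ T ih =>
    obtain ⟨g, hg⟩ := ih
    obtain ⟨l, hl⟩ := H fun v => ∏ j, (if R v (g j) then 1 else 2)
    refine ⟨Fin.cons l g, ?_⟩
    simp only [Fin.prod_univ_succ, Fin.cons_zero, Fin.cons_succ]
    have : ∑ v, (if R v l then 1 else 2) * ∏ j, (if R v (g j) then 1 else 2) =
        ∑ v, ∏ j, (if R v (g j) then 1 else 2) +
          ∑ v, (if R v l then 0 else ∏ j, (if R v (g j) then 1 else 2)) := by
      rw [← sum_add_distrib]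
      refine sum_congr rfl fun v _ => ?_
      split_ifs <;> ring
    rw [this, pow_succ, pow_succ]
    have h4 : 0 < 4 ^ T := by positivity
    nlinarith

open Classical in
lemma boost' {V Λ : Type*} [Fintype V] [Nonempty V] (R : V → Λ → Prop)
    (H : ∀ w : V → ℕ, ∃ l, 4 * ∑ v, (if R v l then 0 else w v) ≤ ∑ v, w v) :
    ∃ T, 0 < T ∧ ∃ g : Fin T → Λ, ∀ v, T ≤ 4 * #(univ.filter fun j => R v (g j)) := by
  set s := Fintype.card V with hs
  have hspos : 0 < s := Fintype.card_pos
  obtain ⟨g, hg⟩ := boost R H (4 * s)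
  refine ⟨4 * s, by omega, g, fun v => ?_⟩
  by_contra! hlt
  have h1 : ∏ j, (if R v (g j) then 1 else 2) ≤ ∑ v, ∏ j, (if R v (g j) then 1 else 2) :=
    single_le_sum (f := fun v => ∏ j, (if R v (g j) then 1 else 2)) (fun _ _ => Nat.zero_le _)
      (mem_univ v)
  rw [prod_ite] at h1
  simp only [prod_const_one, one_mul, prod_const] at h1
  have hc := card_filter_add_card_filter_not (s := (univ : Finset (Fin (4 * s)))) (fun j => R v (g j))
  simp only [card_univ, Fintype.card_fin] at hc
  have h2 : 2 ^ (3 * s) ≤ 2 ^ #(univ.filter fun j => ¬ R v (g j)) :=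
    Nat.pow_le_pow_right (by norm_num) (by omega)
  have h3 : 4 ^ (4 * s) * 2 ^ (3 * s) ≤ 5 ^ (4 * s) * s :=
    (Nat.mul_le_mul_left _ (h2.trans h1)).trans hg
  rw [pow_mul, pow_mul, pow_mul, ← mul_pow] at h3
  have h4 : (625 * 3) ^ s ≤ ((4 ^ 4 * 2 ^ 3) ^ s : ℕ) := Nat.pow_le_pow_left (by norm_num) s
  rw [mul_pow] at h4
  have h5 : 625 ^ s * 3 ^ s ≤ 625 ^ s * s := h4.trans (by simpa using h3)
  have h6 := Nat.le_of_mul_le_mul_left h5 (by positivity)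
  have h7 : s < 3 ^ s := Nat.lt_pow_self (by norm_num)
  omega

end PQ

/-- Dual (p,q)-theorem, finite combinatorial form: for every `k` there are `q` and `n`
such that for any family `𝒮` of VC dimension at most `k` and any finite set `U`,
if every subset of `U` of size at most `q` is contained in some member of `𝒮`,
then `U` is covered by the union of `n` members of `𝒮`. -/
theorem stmt15 (k : ℕ) :
    ∃ q n : ℕ, 0 < q ∧ 0 < n ∧ ∀ (X : Type*) (𝒮 : Set (Set X)), VCDimLE 𝒮 k →
      ∀ U : Finset X,
        (∀ U₀ ⊆ U, U₀.card ≤ q → ∃ S ∈ 𝒮, (U₀ : Set X) ⊆ S) →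
        ∃ f : Fin n → Set X, (∀ i, f i ∈ 𝒮) ∧ (U : Set X) ⊆ ⋃ i, f i := by
  obtain ⟨t, ht, htD⟩ := PQ.exists_t (k + 1)
  obtain ⟨t', ht', htD'⟩ := PQ.exists_t (2 ^ (k + 1))
  refine ⟨8 * t, 8 * t', by omega, by omega, ?_⟩
  classical
  intro X 𝒮 hvc U hU
  rcases U.eq_empty_or_nonempty with rfl | hne
  · obtain ⟨S, hS, -⟩ := hU ∅ (by simp) (by simp)
    exact ⟨fun _ => S, fun _ => hS, by simp⟩
  have : Nonempty U := hne.to_subtype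
  let R : U → 𝒮 → Prop := fun u S => (u : X) ∈ (S : Set X)
  have hR : ¬ PQ.Sh R (Fin (k + 1)) := by
    rintro ⟨x, hx⟩
    have hinj : Function.Injective fun i => (x i : X) := by
      intro i j hij
      obtain ⟨l, hl⟩ := hx {i}
      have h1 := (hl i).2 rfl
      have h2 : R (x j) l := by
        simp only [R] at h1 ⊢
        simp only at hij
        rwa [← hij]
      exact ((hl j).1 h2).symm
    have := hvc (Finset.univ.map ⟨_, hinj⟩) (by
      intro B hB
      obtain ⟨l, hl⟩ := hx {i | (x i : X) ∈ B}
      refine ⟨l, l.2, ?_⟩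
      ext y
      constructor
      · rintro ⟨h1, h2⟩
        simp at h1
        obtain ⟨i, rfl⟩ := h1
        exact (hl i).1 h2
      · intro hy
        have h1 := hB hy
        refine ⟨h1, ?_⟩
        simp at h1
        obtain ⟨i, rfl⟩ := h1
        exact (hl i).2 hy)
    simp at this
  have H : ∀ w : U → ℕ, ∃ l, 4 * ∑ v, (if R v l then 0 else w v) ≤ ∑ v, w v := by
    intro w
    by_cases hw : Nonempty (Σ u : U, Fin (w u))
    · have hR' : ¬ PQ.Sh (fun (a : Σ u : U, Fin (w u)) l => ¬ R a.1 l) (Fin (k + 1)) := by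
        intro h
        obtain ⟨x, hx⟩ := h.compl
        exact hR ⟨fun i => (x i).1, hx⟩
      obtain ⟨x, hx⟩ := PQ.net (by positivity) ht htD hR'
      obtain ⟨S, hS, hxS⟩ := hU (Finset.univ.image fun i => ((x i).1 : X))
        (by intro y; simp; rintro i rfl; exact (x i).1.2)
        (Finset.card_image_le.trans (by simp))
      refine ⟨⟨S, hS⟩, ?_⟩
      by_contra! hlt
      obtain ⟨i, hi⟩ := hx ⟨S, hS⟩ (by
        rw [Finset.card_filter, Fintype.sum_sigma]
        simp only [Fintype.card_sigma, Fintype.card_fin]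
        refine hlt.le.trans (le_of_eq ?_)
        congr 1
        refine Finset.sum_congr rfl fun v _ => ?_
        by_cases hv : R v ⟨S, hS⟩ <;> simp [hv])
      exact hi (hxS (by simp))
    · obtain ⟨S, hS, -⟩ := hU ∅ (by simp) (by simp)
      have : ∀ u, w u = 0 := by
        intro u
        by_contra h
        exact hw ⟨⟨u, ⟨0, Nat.pos_of_ne_zero h⟩⟩⟩
      exact ⟨⟨S, hS⟩, by simp [this]⟩
  obtain ⟨T, hT, g, hg⟩ := PQ.boost' R H
  have : Nonempty (Fin T) := ⟨⟨0, hT⟩⟩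
  have hR2 : ¬ PQ.Sh (fun (j : Fin T) (u : U) => R u (g j)) (Fin (2 ^ (k + 1))) := by
    intro h
    obtain ⟨x, hx⟩ := h.dual
    refine hR ⟨x, fun B => ?_⟩
    obtain ⟨j, hj⟩ := hx B
    exact ⟨g j, hj⟩
  obtain ⟨x, hx⟩ := PQ.net (by positivity) ht' htD' hR2
  refine ⟨fun i => g (x i), fun i => (g (x i)).2, ?_⟩
  intro u hu
  obtain ⟨i, hi⟩ := hx ⟨u, hu⟩ (by simpa using hg ⟨u, hu⟩)
  exact Set.mem_iUnion.2 ⟨i, hi⟩
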